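/- arXiv:1202.2668 — 4 statements merged into one kernel-verified Lean document; each statement's English description precedes it below -/
import Mathlib

section
/- For every multicharge s ∈ ℤ^l and every l-partition λ, the peeling procedure terminates: finitely many iterations of the deletion (λ,s) ↦ (λ⁻,s⁻) starting from (λ,s) reach a pair that is either not e-periodic or equal to (∅,t) with t ∈ T_{l,e}; in particular the pair (λ°,s°) is well defined. Moreover, if λ° = ∅ then s° ∈ T_{l,e}. -/
/- Formalization of combinatorial notions from
   "A combinatorial decomposition of higher level Fock spaces"
   by N. Jacon and C. Lecouvey. -/

open scoped Classical

noncomputable section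

namespace FockHW

/-- An `l`-partition, encoded by `P c i = λ^c_{i+1}` (`i` is the 0-based row index). -/
abbrev MP (l : ℕ) := Fin l → ℕ → ℕ

/-- A multicharge `s ∈ ℤ^l`. -/
abbrev Charge (l : ℕ) := Fin l → ℤ

/-- `P` is a genuine `l`-partition: each component is a weakly decreasing,
eventually zero, sequence of nonnegative integers. -/
def IsLPartition {l : ℕ} (P : MP l) : Prop :=
  (∀ c, Antitone (P c)) ∧ ∀ c, ∃ N, ∀ i, N ≤ i → P c i = 0

/-- The empty `l`-partition. -/
def emptyMP (l : ℕ) : MP l := fun _ _ => 0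

/-- The entry `B(λ,s)^c_{i+1} = λ^c_{i+1} - (i+1) + s_c + 1` of the symbol of `(λ,s)`. -/
def symb {l : ℕ} (P : MP l) (s : Charge l) (c : Fin l) (i : ℕ) : ℤ :=
  (P c i : ℤ) - (i : ℤ) + s c

/-- `v` is an entry of the `c`-th row of the symbol of `(P,s)`. -/
def RowHas {l : ℕ} (P : MP l) (s : Charge l) (c : Fin l) (v : ℤ) : Prop :=
  ∃ i, symb P s c i = v

/-- `k` is the largest entry of the symbol of `(P,s)`. -/
def IsMaxEntry {l : ℕ} (P : MP l) (s : Charge l) (k : ℤ) : Prop :=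
  (∃ c, RowHas P s c k) ∧ ∀ c v, RowHas P s c v → v ≤ k

/-- The data `(k, per)` is an `e`-period of the symbol of `(P,s)`:
`k` is the largest entry, the rows `per 0 ≥ per 1 ≥ …` carry the entries
`k, k-1, …, k-e+1`, and no entry `k-t` occurs in a row strictly below `per t`. -/
def IsEPeriod {l : ℕ} (e : ℕ) (P : MP l) (s : Charge l) (k : ℤ) (per : Fin e → Fin l) : Prop :=
  IsMaxEntry P s k ∧ Antitone per ∧
  ∀ t : Fin e, RowHas P s (per t) (k - ((t : ℕ) : ℤ)) ∧
    ∀ d : Fin l, RowHas P s d (k - ((t : ℕ) : ℤ)) → per t ≤ d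

/-- `(P,s)` is `e`-periodic. -/
def EPeriodic {l : ℕ} (e : ℕ) (P : MP l) (s : Charge l) : Prop :=
  ∃ k per, IsEPeriod e P s k per

/-- `(P',s')` is obtained from `(P,s)` by deleting the `e`-period with data `(k, per)`:
rowwise, the entries of the new symbol are the old ones minus the period entries. -/
def DeletesToWith {l : ℕ} (e : ℕ) (P : MP l) (s : Charge l) (k : ℤ) (per : Fin e → Fin l)
    (P' : MP l) (s' : Charge l) : Prop :=
  IsEPeriod e P s k per ∧ IsLPartition P' ∧
  ∀ d : Fin l, {v : ℤ | RowHas P' s' d v} =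
    {v : ℤ | RowHas P s d v} \ {v : ℤ | ∃ t : Fin e, per t = d ∧ v = k - ((t : ℕ) : ℤ)}

/-- `(P',s')` is obtained from `(P,s)` by deleting the `e`-period. -/
def DeletesTo {l : ℕ} (e : ℕ) (P : MP l) (s : Charge l) (P' : MP l) (s' : Charge l) : Prop :=
  ∃ k per, DeletesToWith e P s k per P' s'

/-- One step of the map `(λ,s) ↦ (λ⁻,s⁻)`: delete the `e`-period if `(λ,s)` is
`e`-periodic, do nothing otherwise. -/
def DeleteStep {l : ℕ} (e : ℕ) (P : MP l) (s : Charge l) (P' : MP l) (s' : Charge l) : Prop :=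
  (¬ EPeriodic e P s ∧ P' = P ∧ s' = s) ∨ DeletesTo e P s P' s'

/-- The set `T_{l,e}` of weakly increasing multicharges with spread at most `e-1`. -/
def Tle (l e : ℕ) : Set (Charge l) :=
  {t | Monotone t ∧ ∀ c d : Fin l, t d - t c ≤ (e : ℤ) - 1}

/-- The peeling procedure applied to `(P,s)` terminates at `(∅,t)`:
there is a chain of `e`-period deletions from `(P,s)` to `(∅,t)` with `t ∈ T_{l,e}`,
not passing through any `(∅,t')` with `t' ∈ T_{l,e}` earlier (so `λ° = ∅`, `s° = t`). -/
def PeelChainTo {l : ℕ} (e : ℕ) (P : MP l) (s : Charge l) (t : Charge l) : Prop :=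
  t ∈ Tle l e ∧ ∃ (n : ℕ) (g : ℕ → MP l × Charge l), g 0 = (P, s) ∧
    (∀ m, m < n → ¬((g m).1 = emptyMP l ∧ (g m).2 ∈ Tle l e) ∧
      DeletesTo e (g m).1 (g m).2 (g (m+1)).1 (g (m+1)).2) ∧
    g n = (emptyMP l, t)

/-- `(P,s)` is totally periodic: the peeling procedure ends with the empty
`l`-partition and a multicharge in `T_{l,e}`. -/
def TotallyPeriodic {l : ℕ} (e : ℕ) (P : MP l) (s : Charge l) : Prop :=
  ∃ t, PeelChainTo e P s t

/-- Indicator (valued in `ℤ`) of an addable node of content `x` in component `c`. -/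
def addA {l : ℕ} (P : MP l) (s : Charge l) (c : Fin l) (x : ℤ) : ℤ :=
  if RowHas P s c x ∧ ¬ RowHas P s c (x + 1) then 1 else 0

/-- Indicator (valued in `ℤ`) of a removable node of content `x` in component `c`. -/
def remR {l : ℕ} (P : MP l) (s : Charge l) (c : Fin l) (x : ℤ) : ℤ :=
  if RowHas P s c (x + 1) ∧ ¬ RowHas P s c x then 1 else 0

/-- `#R - #A` on the suffix of the `j`-word (`e = ∞`) starting at the node of
content `j` in component `c0` (the `j`-word is ordered by decreasing component). -/
def suffInf {l : ℕ} (P : MP l) (s : Charge l) (j : ℤ) (c0 : Fin l) : ℤ :=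
  ∑ c ∈ Finset.univ.filter (fun c : Fin l => c ≤ c0), (remR P s c j - addA P s c j)

/-- `#A - #R` on the prefix of the `j`-word (`e = ∞`) ending at the node of
content `j` in component `c0`. -/
def prefInf {l : ℕ} (P : MP l) (s : Charge l) (j : ℤ) (c0 : Fin l) : ℤ :=
  ∑ c ∈ Finset.univ.filter (fun c : Fin l => c0 ≤ c), (addA P s c j - remR P s c j)

/-- `ε^∞_j(λ)`: the number of `R`'s in the reduced `j`-word of `λ` (`e = ∞`),
computed as the largest value of `#R - #A` over suffixes of the `j`-word. -/
def epsInf {l : ℕ} (P : MP l) (s : Charge l) (j : ℤ) : ℤ :=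
  sSup (insert 0 {z : ℤ | ∃ c0, z = suffInf P s j c0})

/-- `φ^∞_j(λ)`: the number of `A`'s in the reduced `j`-word of `λ` (`e = ∞`). -/
def phiInf {l : ℕ} (P : MP l) (s : Charge l) (j : ℤ) : ℤ :=
  sSup (insert 0 {z : ℤ | ∃ c0, z = prefInf P s j c0})

/-- The `sl∞`-weight `wt(λ,s)_∞ = Σ_j (φ^∞_j - ε^∞_j) Λ_j` of `(λ,s)`,
as a function giving the coordinate on each `Λ_j`. -/
def wtInf {l : ℕ} (P : MP l) (s : Charge l) : ℤ → ℤ :=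
  fun j => phiInf P s j - epsInf P s j

/-- `#R - #A` on the suffix of the `i`-word (residues mod `e`) starting at the
node of content `x0` in component `c0`. -/
def suffE {l : ℕ} (e : ℕ) (P : MP l) (s : Charge l) (i : ZMod e) (x0 : ℤ) (c0 : Fin l) : ℤ :=
  ∑ᶠ x : ℤ, if (x : ZMod e) = i then
      (if x0 < x then ∑ c : Fin l, (remR P s c x - addA P s c x)
       else if x = x0 then suffInf P s x c0 else 0)
    else 0

/-- `#A - #R` on the prefix of the `i`-word ending at the node of content `x0`
in component `c0`. -/
def prefE {l : ℕ} (e : ℕ) (P : MP l) (s : Charge l) (i : ZMod e) (x0 : ℤ) (c0 : Fin l) : ℤ :=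
  ∑ᶠ x : ℤ, if (x : ZMod e) = i then
      (if x < x0 then ∑ c : Fin l, (addA P s c x - remR P s c x)
       else if x = x0 then prefInf P s x c0 else 0)
    else 0

/-- `ε_i(λ)`: the number of `R`'s in the reduced `i`-word of `λ`, computed as the
largest value of `#R - #A` over suffixes of the `i`-word. -/
def epsE {l : ℕ} (e : ℕ) (P : MP l) (s : Charge l) (i : ZMod e) : ℤ :=
  sSup (insert 0 {z : ℤ | ∃ x0 c0, z = suffE e P s i x0 c0})

/-- `φ_i(λ)`: the number of `A`'s in the reduced `i`-word of `λ`. -/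
def phiE {l : ℕ} (e : ℕ) (P : MP l) (s : Charge l) (i : ZMod e) : ℤ :=
  sSup (insert 0 {z : ℤ | ∃ x0 c0, z = prefE e P s i x0 c0})

/-- The fundamental weight `Λ_{j0}` of `P_∞`, as a coordinate function. -/
def Lam (j0 : ℤ) : ℤ → ℤ := fun j => if j = j0 then 1 else 0

/-- The level-zero weight `ω_k = Λ_{k+1} - Λ_{k-e+1}`. -/
def omegaW (e : ℕ) (k : ℤ) : ℤ → ℤ := fun j => Lam (k + 1) j - Lam (k - (e : ℤ) + 1) j

/-- `Λ_{t,∞} = Λ_{t_0} + … + Λ_{t_{l-1}}`. -/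
def LamCh {l : ℕ} (t : Charge l) : ℤ → ℤ := fun j => ∑ c : Fin l, Lam (t c) j

/-- The node of content `x` in component `c` is the good addable `i`-node of `λ`:
it is addable, of residue `i`, and it is the leftmost node in the `i`-word at which
the prefix count `#A - #R` attains its maximum `φ_i(λ)` (equivalently it corresponds
to the rightmost `A` of the reduced `i`-word). -/
def IsGoodAddableE {l : ℕ} (e : ℕ) (P : MP l) (s : Charge l) (i : ZMod e)
    (x : ℤ) (c : Fin l) : Prop :=
  addA P s c x = 1 ∧ (x : ZMod e) = i ∧ prefE e P s i x c = phiE e P s i ∧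
  ∀ (x' : ℤ) (c' : Fin l), addA P s c' x' = 1 → (x' : ZMod e) = i →
    prefE e P s i x' c' = phiE e P s i → (x < x' ∨ (x = x' ∧ c' ≤ c))

/-- The node of content `x` in component `c` is the good addable `x`-node of `λ`
for the `e = ∞` structure. -/
def IsGoodAddableInf {l : ℕ} (P : MP l) (s : Charge l) (x : ℤ) (c : Fin l) : Prop :=
  addA P s c x = 1 ∧ prefInf P s x c = phiInf P s x ∧
  ∀ c' : Fin l, addA P s c' x = 1 → prefInf P s x c' = phiInf P s x → c' ≤ c

/-- One step of the `RA`-cancellation: the state is a reduced word `A^p R^q`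
(encoded `(p,q)`), and a new letter (`true` = `A`, `false` = `R`) is appended. -/
def reduceStep : ℕ × ℕ → Bool → ℕ × ℕ
  | (p, q), true => if q = 0 then (p + 1, 0) else (p, q - 1)
  | (p, q), false => (p, q + 1)

/-- The result `A^p R^q` of recursively deleting the factors `RA` in a word
(`true` = `A`, `false` = `R`). -/
def reduceRA (w : List Bool) : ℕ × ℕ := w.foldl reduceStep (0, 0)

/-- The word `u_j`: reading the entries `j` and `j+1` of the symbol, rows from
top to bottom, each row from right to left, encoding `j` by `A` and `j+1` by `R`. -/
def ujWord {l : ℕ} (P : MP l) (s : Charge l) (j : ℤ) : List Bool :=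
  ((List.finRange l).reverse.map (fun c =>
    (if RowHas P s c (j + 1) then [false] else []) ++
    (if RowHas P s c j then [true] else []))).flatten

/-- The word `u_i = u_{jlow} u_{jlow+e} u_{jlow+2e} ⋯` (truncated after `B` factors). -/
def uiWord {l : ℕ} (e : ℕ) (P : MP l) (s : Charge l) (jlow : ℤ) (B : ℕ) : List Bool :=
  ((List.range B).map (fun tt => ujWord P s (jlow + (tt : ℤ) * (e : ℤ)))).flatten

/-- `m` is admissible for the symbol of `(P,s)`: every row contains every integer `< m`. -/
def Admissible {l : ℕ} (P : MP l) (s : Charge l) (m : ℤ) : Prop :=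
  ∀ c, ∀ v : ℤ, v < m → RowHas P s c v

/-- The number of entries `≥ m` in row `c` of the symbol of `(P,s)`. -/
def nGE {l : ℕ} (P : MP l) (s : Charge l) (c : Fin l) (m : ℤ) : ℕ :=
  {i : ℕ | m ≤ symb P s c i}.ncard

/-- The symbol of `(P,s)` is semistandard: for every admissible `m` and every `j`,
the `j`-th smallest entry `≥ m` of row `c` is at least the `j`-th smallest entry
`≥ m` of row `c+1`, whenever both are defined. -/
def Semistandard {l : ℕ} (P : MP l) (s : Charge l) : Prop :=
  ∀ m : ℤ, Admissible P s m → ∀ c : Fin l, ∀ hc : (c : ℕ) + 1 < l, ∀ j : ℕ,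
    1 ≤ j → j ≤ nGE P s c m → j ≤ nGE P s ⟨(c : ℕ) + 1, hc⟩ m →
    symb P s ⟨(c : ℕ) + 1, hc⟩ (nGE P s ⟨(c : ℕ) + 1, hc⟩ m - j) ≤
      symb P s c (nGE P s c m - j)

/-- The box in row `c`, column `x`, belongs to the skew shape `u∖t`. -/
def InShape {l : ℕ} (u t : Charge l) (c : Fin l) (x : ℤ) : Prop := t c < x ∧ x ≤ u c

/-- `τ` is a skew (semistandard) tableau of shape `u∖t` (normalized by `0` outside
the shape): rows strictly increase from left to right, columns weakly increase
from top (row `l-1`) to bottom (row `0`). -/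
def IsSkewTableau {l : ℕ} (u t : Charge l) (τ : Fin l → ℤ → ℤ) : Prop :=
  (∀ c x, ¬ InShape u t c x → τ c x = 0) ∧
  (∀ c x, InShape u t c x → InShape u t c (x + 1) → τ c x < τ c (x + 1)) ∧
  (∀ (c : Fin l) (hc : (c : ℕ) + 1 < l) (x : ℤ),
    InShape u t c x → InShape u t ⟨(c : ℕ) + 1, hc⟩ x → τ ⟨(c : ℕ) + 1, hc⟩ x ≤ τ c x)

/-- The box `b` is read strictly before the box `b'` in the reading word of a skew
tableau (rows from top to bottom, right to left within each row). -/
def ReadBefore {l : ℕ} (b b' : Fin l × ℤ) : Prop :=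
  b'.1 < b.1 ∨ (b.1 = b'.1 ∧ b'.2 < b.2)

/-- `(M, q)` is the `e`-period of the skew tableau `τ` of shape `u∖t`:
`M` is the largest entry, `q k` is the last box in reading order with entry `M-k`,
and these boxes occur in increasing reading order. -/
def IsTabPeriod {l : ℕ} (e : ℕ) (u t : Charge l) (τ : Fin l → ℤ → ℤ) (M : ℤ)
    (q : Fin e → Fin l × ℤ) : Prop :=
  (∃ c x, InShape u t c x ∧ τ c x = M) ∧
  (∀ c x, InShape u t c x → τ c x ≤ M) ∧
  (∀ k : Fin e, InShape u t (q k).1 (q k).2 ∧ τ (q k).1 (q k).2 = M - ((k : ℕ) : ℤ) ∧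
    ∀ c x, InShape u t c x → τ c x = M - ((k : ℕ) : ℤ) → (c, x) ≠ q k →
      ReadBefore (c, x) (q k)) ∧
  ∀ (k : Fin e) (hk : (k : ℕ) + 1 < e), ReadBefore (q k) (q ⟨(k : ℕ) + 1, hk⟩)

/-- `(u',τ')` is obtained from the skew tableau `(u,τ)` (inner shape `t`) by deleting
the boxes of its `e`-period. -/
def TabDeletesTo {l : ℕ} (e : ℕ) (u t : Charge l) (τ : Fin l → ℤ → ℤ)
    (u' : Charge l) (τ' : Fin l → ℤ → ℤ) : Prop :=
  ∃ M q, IsTabPeriod e u t τ M q ∧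
    (∀ c : Fin l, u' c = u c - ((Finset.univ.filter (fun k : Fin e => (q k).1 = c)).card : ℤ)) ∧
    (∀ k : Fin e, u' (q k).1 < (q k).2) ∧
    τ' = fun c x => if InShape u' t c x then τ c x else 0

/-- The trivial tableau of shape `u∖t`: row `c` contains `t_c+1, …, u_c`. -/
def trivialTab {l : ℕ} (u t : Charge l) : Fin l → ℤ → ℤ :=
  fun c x => if InShape u t c x then x else 0

/-- The skew tableau `τ` of shape `u∖t` is totally `e`-periodic: iterated deletion of
`e`-periods (never stopping early at a trivial tableau with charge in `T_{l,e}`)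
empties the tableau. -/
def TabTotallyPeriodic {l : ℕ} (e : ℕ) (u t : Charge l) (τ : Fin l → ℤ → ℤ) : Prop :=
  ∃ (n : ℕ) (G : ℕ → Charge l × (Fin l → ℤ → ℤ)), G 0 = (u, τ) ∧
    (∀ m, m < n → ¬((G m).2 = trivialTab (G m).1 t ∧ (G m).1 ∈ Tle l e) ∧
      TabDeletesTo e (G m).1 t (G m).2 (G (m+1)).1 (G (m+1)).2) ∧
    (G n).1 = t

/-- The set `Tab^e_{u∖t}` of totally periodic skew tableaux of shape `u∖t`
(row `c` contains only integers `> t_c`). -/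
def TabSet {l : ℕ} (e : ℕ) (u t : Charge l) : Set (Fin l → ℤ → ℤ) :=
  {τ | IsSkewTableau u t τ ∧ (∀ c x, InShape u t c x → t c < τ c x) ∧
       TabTotallyPeriodic e u t τ}

/-- The `sl∞`-weight `wt(τ)_∞ = Σ_b ε_{τ(b)}` of a skew tableau, as a coordinate
function on the `Λ_j`. -/
def wtTab {l : ℕ} (u t : Charge l) (τ : Fin l → ℤ → ℤ) : ℤ → ℤ :=
  fun j => ({p : Fin l × ℤ | InShape u t p.1 p.2 ∧ τ p.1 p.2 = j - 1}.ncard : ℤ)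
         - ({p : Fin l × ℤ | InShape u t p.1 p.2 ∧ τ p.1 p.2 = j}.ncard : ℤ)

/-- `Tab^e_{u∖t,γ}`: totally periodic skew tableaux of shape `u∖t` and weight `γ`. -/
def TabSetWt {l : ℕ} (e : ℕ) (u t : Charge l) (γ : ℤ → ℤ) : Set (Fin l → ℤ → ℤ) :=
  {τ ∈ TabSet e u t | wtTab u t τ = γ}

/-- The level-`0` part `B(λ,s)_0` of a symbol: the skew tableau of shape `s∖t`
whose row `c` lists, in increasing order, the entries `> t_c` of row `c` of the
symbol of `(P,s)` (these are the entries deleted during the peeling when `s° = t`). -/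
def level0 {l : ℕ} (P : MP l) (s t : Charge l) : Fin l → ℤ → ℤ :=
  fun c x =>
    if t c < x ∧ x ≤ s c then
      sInf {u : ℤ | RowHas P s c u ∧ t c < u ∧
        ({v : ℤ | RowHas P s c v ∧ t c < v ∧ v ≤ u}.ncard : ℤ) = x - t c}
    else 0

/-- The Young diagram `λ(v)`: the conjugate of the partition
`(v_{l-1}-v_0, v_{l-2}-v_0, …, v_1-v_0)`, as a set of boxes `(row, column)`. -/
def lamShape {l : ℕ} (hl : 0 < l) (v : Charge l) : Set (ℕ × ℕ) :=
  {rc | rc.2 + 1 < l ∧ (rc.1 : ℤ) < v ⟨l - 1 - rc.2, by omega⟩ - v ⟨0, hl⟩}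

/-- The set of semistandard Young tableaux of shape `λ(v)` and weight
`μ(v) = (s_0 - v_0, …, s_{l-1} - v_0)`; its cardinality is the Kostka number
`K_{λ(v),μ(v)}`. -/
def KostkaSet {l : ℕ} (hl : 0 < l) (v s : Charge l) : Set (ℕ → ℕ → ℕ) :=
  {T | (∀ r c, (r, c) ∉ lamShape hl v → T r c = 0) ∧
       (∀ r c, (r, c) ∈ lamShape hl v → 1 ≤ T r c ∧ T r c ≤ l) ∧
       (∀ r c, (r, c) ∈ lamShape hl v → (r, c + 1) ∈ lamShape hl v → T r c ≤ T r (c + 1)) ∧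
       (∀ r c, (r, c) ∈ lamShape hl v → (r + 1, c) ∈ lamShape hl v → T r c < T (r + 1) c) ∧
       ∀ cc : Fin l,
         (({rc : ℕ × ℕ | rc ∈ lamShape hl v ∧ T rc.1 rc.2 = (cc : ℕ) + 1}.ncard : ℤ))
           = s cc - v ⟨0, hl⟩}

/-- `w` is a reverse lattice (Yamanouchi) word: it can be decomposed into disjoint
subwords of the form `a (a-1) (a-2) ⋯ min(w)`. -/
def IsReverseLatticeWord (w : List ℤ) : Prop :=
  w = [] ∨ ∃ mn : ℤ, mn ∈ w ∧ (∀ x ∈ w, mn ≤ x) ∧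
    ∃ (r : ℕ) (col : Fin w.length → Fin r) (a : Fin r → ℤ),
      (∀ p : Fin w.length,
        w.get p = a (col p) -
          ((Finset.univ.filter (fun q : Fin w.length => q < p ∧ col q = col p)).card : ℤ)) ∧
      ∀ jj : Fin r,
        ((Finset.univ.filter (fun p : Fin w.length => col p = jj)).card : ℤ) = a jj - mn + 1

/-- The word obtained by reading the entries `≥ m` of the symbol of `(P,s)`,
rows from top to bottom, each row from right to left (i.e. in decreasing order). -/
def readWordGE {l : ℕ} (P : MP l) (s : Charge l) (m : ℤ) : List ℤ :=
  ((List.finRange l).reverse.map (fun c =>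
     (List.range (nGE P s c m)).map (fun i => symb P s c i))).flatten


/-- Remove the first `r c` entries of every row `c` of the symbol of `x`. -/
def dropRows {l : ℕ} (x : MP l × Charge l) (r : Fin l → ℕ) : MP l × Charge l :=
  (fun c i => x.1 c (i + r c), fun c => x.2 c - r c)

/-- The `e`-period `(k, per)` of `x` consists of the first `r c` entries of every row `c`. -/
def PeriodDrops {l : ℕ} (e : ℕ) (x : MP l × Charge l) (k : ℤ) (per : Fin e → Fin l)
    (r : Fin l → ℕ) : Prop :=
  IsEPeriod e x.1 x.2 k per ∧
    ∀ c i, (∃ t : Fin e, per t = c ∧ symb x.1 x.2 c i = k - ((t : ℕ) : ℤ)) ↔ i < r c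

lemma symb_dropRows {l : ℕ} (x : MP l × Charge l) (r : Fin l → ℕ) (c : Fin l) (i : ℕ) :
    symb (dropRows x r).1 (dropRows x r).2 c i = symb x.1 x.2 c (i + r c) := by
  simp only [symb, dropRows]
  push_cast
  ring

lemma IsLPartition.dropRows {l : ℕ} {x : MP l × Charge l} (h : IsLPartition x.1)
    (r : Fin l → ℕ) : IsLPartition (dropRows x r).1 := by
  refine ⟨fun c i j hij => h.1 c (by omega), fun c => ?_⟩
  obtain ⟨N, hN⟩ := h.2 c
  exact ⟨N, fun i hi => hN _ (by omega)⟩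

lemma IsLPartition.symb_strictAnti {l : ℕ} {P : MP l} (h : IsLPartition P) (s : Charge l)
    (c : Fin l) : StrictAnti (symb P s c) := by
  intro i j hij
  have := h.1 c hij.le
  simp only [symb]
  omega

lemma IsEPeriod.exists_periodDrops {l e : ℕ} {x : MP l × Charge l} (hx : IsLPartition x.1)
    {k : ℤ} {per : Fin e → Fin l} (h : IsEPeriod e x.1 x.2 k per) :
    ∃ r, PeriodDrops e x k per r := by
  suffices ∀ c, ∃ r : ℕ, ∀ i,
      (∃ t : Fin e, per t = c ∧ symb x.1 x.2 c i = k - ((t : ℕ) : ℤ)) ↔ i < r by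
    choose r hr using this
    exact ⟨r, h, hr⟩
  intro c
  have hlower : ∀ i j, j ≤ i →
      (∃ t : Fin e, per t = c ∧ symb x.1 x.2 c i = k - ((t : ℕ) : ℤ)) →
      ∃ t : Fin e, per t = c ∧ symb x.1 x.2 c j = k - ((t : ℕ) : ℤ) := by
    rintro i j hji ⟨t, htc, ht⟩
    have hle := (hx.symb_strictAnti x.2 c).antitone hji
    have hk : symb x.1 x.2 c j ≤ k := h.1.2 c _ ⟨j, rfl⟩
    have htt : (k - symb x.1 x.2 c j).toNat ≤ t := by omega
    let t' : Fin e := ⟨(k - symb x.1 x.2 c j).toNat, htt.trans_lt t.2⟩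
    have hv : symb x.1 x.2 c j = k - ((t' : ℕ) : ℤ) := by
      simp only [t']
      omega
    refine ⟨t', le_antisymm ((h.2.2 t').2 c ⟨j, hv⟩) ?_, hv⟩
    rw [← htc]
    exact h.2.1 (show t' ≤ t from htt)
  have hex : ∃ i, ¬ ∃ t : Fin e, per t = c ∧ symb x.1 x.2 c i = k - ((t : ℕ) : ℤ) := by
    refine ⟨(x.1 c 0 + x.2 c - k + e).toNat, ?_⟩
    rintro ⟨t, -, ht⟩
    have h0 := hx.1 c (Nat.zero_le (x.1 c 0 + x.2 c - k + e).toNat)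
    have := t.2
    simp only [symb] at ht
    omega
  refine ⟨Nat.find hex, fun i => ⟨fun hi => ?_, fun hi => not_not.1 (Nat.find_min hex hi)⟩⟩
  by_contra hlt
  exact Nat.find_spec hex (hlower i _ (not_lt.1 hlt) hi)

lemma PeriodDrops.rowHas_iff {l e : ℕ} {x : MP l × Charge l} {k : ℤ} {per : Fin e → Fin l}
    {r : Fin l → ℕ} (h : PeriodDrops e x k per r) (c : Fin l) (v : ℤ) :
    RowHas (dropRows x r).1 (dropRows x r).2 c v ↔
      RowHas x.1 x.2 c v ∧ ¬ ∃ t : Fin e, per t = c ∧ v = k - ((t : ℕ) : ℤ) := by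
  simp only [RowHas, symb_dropRows]
  constructor
  · rintro ⟨i, rfl⟩
    refine ⟨⟨_, rfl⟩, fun ht => ?_⟩
    have := (h.2 c _).1 ht
    omega
  · rintro ⟨⟨i, rfl⟩, hi⟩
    rw [h.2 c i, not_lt] at hi
    exact ⟨i - r c, by rw [Nat.sub_add_cancel hi]⟩

lemma PeriodDrops.deletesTo {l e : ℕ} {x : MP l × Charge l} (hx : IsLPartition x.1) {k : ℤ}
    {per : Fin e → Fin l} {r : Fin l → ℕ} (h : PeriodDrops e x k per r) :
    DeletesTo e x.1 x.2 (dropRows x r).1 (dropRows x r).2 :=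
  ⟨k, per, h.1, hx.dropRows r, fun d => Set.ext fun v => h.rowHas_iff d v⟩

lemma PeriodDrops.exists_pos {l e : ℕ} (he : 0 < e) {x : MP l × Charge l} {k : ℤ}
    {per : Fin e → Fin l} {r : Fin l → ℕ} (h : PeriodDrops e x k per r) : ∃ c, 0 < r c := by
  obtain ⟨i, hi⟩ := (h.1.2.2 ⟨0, he⟩).1
  exact ⟨_, (Nat.zero_le i).trans_lt ((h.2 _ i).1 ⟨⟨0, he⟩, rfl, hi⟩)⟩

lemma rowHas_emptyMP {l : ℕ} (s : Charge l) (c : Fin l) (v : ℤ) :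
    RowHas (emptyMP l) s c v ↔ v ≤ s c := by
  simp only [RowHas, symb, emptyMP]
  constructor
  · rintro ⟨i, rfl⟩
    omega
  · intro h
    exact ⟨(s c - v).toNat, by omega⟩

lemma exists_isMaxEntry_emptyMP {l : ℕ} (hl : 0 < l) (s : Charge l) :
    ∃ k, IsMaxEntry (emptyMP l) s k := by
  have : Nonempty (Fin l) := ⟨⟨0, hl⟩⟩
  obtain ⟨c, hc⟩ := Finite.exists_max s
  refine ⟨s c, ⟨c, (rowHas_emptyMP ..).2 le_rfl⟩, fun d v hv => ?_⟩
  exact ((rowHas_emptyMP ..).1 hv).trans (hc d)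

/-- The symbol of an empty `l`-partition is always `e`-periodic. -/
lemma ePeriodic_emptyMP {l : ℕ} (e : ℕ) (hl : 0 < l) (s : Charge l) :
    EPeriodic e (emptyMP l) s := by
  obtain ⟨k, hk⟩ := exists_isMaxEntry_emptyMP hl s
  have hmin : ∀ t : Fin e, ∃ c, k - ((t : ℕ) : ℤ) ≤ s c ∧
      ∀ d, k - ((t : ℕ) : ℤ) ≤ s d → c ≤ d := by
    intro t
    obtain ⟨c, hc⟩ := hk.1
    rw [rowHas_emptyMP] at hc
    obtain ⟨m, hm⟩ := Set.Finite.exists_minimal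
      (Set.toFinite {c : Fin l | k - ((t : ℕ) : ℤ) ≤ s c})
      ⟨c, show k - ((t : ℕ) : ℤ) ≤ s c by omega⟩
    exact ⟨m, hm.1, fun d hd => (le_total m d).elim id (hm.2 hd)⟩
  choose per hper hper' using hmin
  refine ⟨k, per, hk, fun t u htu => hper' u _ ?_, fun t => ?_⟩
  · have : (t : ℕ) ≤ u := htu
    have := hper t
    omega
  · simp only [rowHas_emptyMP]
    exact ⟨hper t, hper' t⟩

/-- Deleting the period of an empty `l`-partition replaces the charge `a` by the charge with
entries `min (a c) (max (k - e) (max_{d < c} a d))`. -/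
lemma PeriodDrops.le_iff_of_empty {l e : ℕ} {x : MP l × Charge l} (hx : x.1 = emptyMP l) {k : ℤ}
    {per : Fin e → Fin l} {r : Fin l → ℕ} (h : PeriodDrops e x k per r) (c : Fin l) (v : ℤ) :
    v ≤ (dropRows x r).2 c ↔ v ≤ x.2 c ∧ (v ≤ k - e ∨ ∃ d < c, v ≤ x.2 d) := by
  have hy : (dropRows x r).1 = emptyMP l := by
    simp only [dropRows, hx]
    rfl
  have hrow := h.rowHas_iff c v
  have hper := h.1
  rw [hy, hx, rowHas_emptyMP, rowHas_emptyMP] at hrow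
  rw [hx] at hper
  obtain ⟨⟨-, hk⟩, -, hper⟩ := hper
  simp only [rowHas_emptyMP] at hk hper
  rw [hrow]
  refine and_congr_right fun hv => ?_
  have hvk := hk c v hv
  constructor
  · intro hnot
    by_cases hve : v ≤ k - e
    · exact .inl hve
    · let t : Fin e := ⟨(k - v).toNat, by omega⟩
      have ht : v = k - ((t : ℕ) : ℤ) := by
        simp only [t]
        omega
      obtain ⟨h1, h2⟩ := hper t
      rw [← ht] at h1 h2
      exact .inr ⟨per t, lt_of_le_of_ne (h2 c hv) fun hc => hnot ⟨t, hc, ht⟩, h1⟩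
  · rintro hor ⟨t, rfl, rfl⟩
    rcases hor with hlt | ⟨d, hd, hvd⟩
    · have := t.2
      omega
    · exact absurd ((hper t).2 d hvd) (not_le.2 hd)

/-- A sequence of charges evolving as the charge of an empty `l`-partition under deletion of
periods, with largest entries `k n` tending to `-∞`, meets `T_{l,e}`. -/
lemma exists_mem_Tle_of_le_iff {l e : ℕ} (a : ℕ → Charge l) (k : ℕ → ℤ)
    (hmax : ∀ n, (∃ c, k n ≤ a n c) ∧ ∀ c, a n c ≤ k n)
    (hstep : ∀ n c v, v ≤ a (n + 1) c ↔ v ≤ a n c ∧ (v ≤ k n - e ∨ ∃ d < c, v ≤ a n d))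
    (hlim : ∀ K, ∃ n, k n ≤ K) : ∃ n, a n ∈ Tle l e := by
  have hle : ∀ n c, a (n + 1) c ≤ a n c := fun n c => ((hstep n c _).1 le_rfl).1
  have hmin : ∀ n c v, v ≤ a n c → v ≤ k n - e → v ≤ a (n + 1) c := fun n c v h1 h2 =>
    (hstep n c v).2 ⟨h1, .inl h2⟩
  have hkle : ∀ n, k (n + 1) ≤ k n := by
    intro n
    obtain ⟨c, hc⟩ := (hmax (n + 1)).1
    exact hc.trans ((hle n c).trans ((hmax n).2 c))
  have hanti : Antitone k := antitone_nat_of_succ_le hkle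
  obtain ⟨N, hN⟩ : ∃ N, ∀ n, N ≤ n → ∀ c, k n - e ≤ a n c := by
    obtain ⟨m, hm⟩ := (Set.finite_range (a 0)).bddBelow
    obtain ⟨N, hN⟩ := hlim m
    have hlow : ∀ n c, min m (k n - e) ≤ a n c := by
      intro n
      induction n with
      | zero => exact fun c => (min_le_left _ _).trans (hm ⟨c, rfl⟩)
      | succ n ih =>
        intro c
        have := hkle n
        have := ih c
        exact hmin n c _ (by omega) (by omega)
    refine ⟨N, fun n hn c => ?_⟩
    have := hanti hn
    have := hlow n c
    omega
  have hsort : ∀ j n, N + j ≤ n → ∀ c d : Fin l, (c : ℕ) < j → c ≤ d → a n c ≤ a n d := by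
    intro j
    induction j with
    | zero => intro _ _ _ _ h; omega
    | succ j ih =>
      intro n hn c d hc hcd
      obtain ⟨n, rfl⟩ : ∃ m, n = m + 1 := ⟨n - 1, by omega⟩
      obtain ⟨-, h2⟩ := (hstep n c _).1 le_rfl
      rcases h2 with h2 | ⟨d', hd', h2⟩
      · exact hmin n d _ (h2.trans (hN n (by omega) d)) h2
      · refine (hstep n d _).2 ⟨h2.trans ?_, .inr ⟨d', hd'.trans_le hcd, h2⟩⟩
        have : (d' : ℕ) < c := hd'
        exact ih n (by omega) d' d (by omega) (hd'.le.trans hcd)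
  obtain ⟨n, hn, hdrop⟩ : ∃ n, N + l ≤ n ∧ k (n + 1) < k n := by
    by_contra! hcon
    have hconst : ∀ n, N + l ≤ n → k (N + l) ≤ k n := fun n hn => by
      induction n, hn using Nat.le_induction with
      | base => exact le_rfl
      | succ n hn ih => exact ih.trans (hcon n hn)
    obtain ⟨n, hn⟩ := hlim (k (N + l) - 1)
    have h1 := hconst (n + (N + l)) (by omega)
    have h2 := hanti (show n ≤ n + (N + l) by omega)
    omega
  refine ⟨n + 1, fun c d hcd => hsort l (n + 1) (by omega) c d c.2 hcd, fun c d => ?_⟩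
  have h1 := hmin n c _ (hN n (by omega) c) le_rfl
  have h2 := (hmax (n + 1)).2 d
  omega

/-- In an infinite sequence of deletions of periods every row loses arbitrarily many entries. -/
lemma exists_le_sum_of_periodDrops {l e : ℕ} (he : 0 < e) {g : ℕ → MP l × Charge l}
    {k : ℕ → ℤ} {per : ℕ → Fin e → Fin l} {r : ℕ → Fin l → ℕ} (h0 : IsLPartition (g 0).1)
    (hg : ∀ n, g n = dropRows (g 0) fun c => ∑ m ∈ Finset.range n, r m c)
    (hr : ∀ n, PeriodDrops e (g n) (k n) (per n) (r n)) (c : Fin l) (M : ℕ) :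
    ∃ n, M ≤ ∑ m ∈ Finset.range n, r m c := by
  by_contra! hcon
  have hk : ∀ n, (g 0).2 c - M ≤ k n := by
    intro n
    have h1 := (hr n).1.1.2 c _ ⟨0, rfl⟩
    have h2 := hcon n
    rw [hg n, symb_dropRows] at h1
    simp only [symb] at h1
    omega
  have hbound : ∀ d n, (∑ m ∈ Finset.range n, r m d) ≤
      ((g 0).1 d 0 + (g 0).2 d - (g 0).2 c + M + e + 1).toNat := by
    intro d n
    induction n with
    | zero => simp
    | succ n ih =>
      rw [Finset.sum_range_succ]
      rcases Nat.eq_zero_or_pos (r n d) with hzero | hpos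
      · rwa [hzero, add_zero]
      · obtain ⟨t, -, ht⟩ := ((hr n).2 d (r n d - 1)).2 (by omega)
        rw [hg n, symb_dropRows] at ht
        have hP := h0.1 d (Nat.zero_le (r n d - 1 + ∑ m ∈ Finset.range n, r m d))
        have := hk n
        have := t.2
        simp only [symb] at ht
        omega
  have hsum : ∀ n, n ≤ ∑ d, ∑ m ∈ Finset.range n, r m d := by
    intro n
    rw [Finset.sum_comm]
    calc n = ∑ _m ∈ Finset.range n, 1 := by simp
      _ ≤ _ := Finset.sum_le_sum fun m _ => by
        obtain ⟨d, hd⟩ := (hr m).exists_pos he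
        exact Nat.succ_le_of_lt (hd.trans_le (Finset.single_le_sum (f := r m) (fun _ _ => Nat.zero_le _)
          (Finset.mem_univ d)))
  have h1 := hsum ((∑ d, ((g 0).1 d 0 + (g 0).2 d - (g 0).2 c + M + e + 1).toNat) + 1)
  have h2 := h1.trans (Finset.sum_le_sum fun d _ => hbound d _)
  omega

/-- An infinite sequence of deletions of periods meets an empty `l`-partition with multicharge
in `T_{l,e}`. -/
lemma exists_empty_of_periodDrops {l e : ℕ} (he : 0 < e) {g : ℕ → MP l × Charge l}
    {k : ℕ → ℤ} {per : ℕ → Fin e → Fin l} {r : ℕ → Fin l → ℕ} (h0 : IsLPartition (g 0).1)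
    (hg : ∀ n, g (n + 1) = dropRows (g n) (r n))
    (hr : ∀ n, PeriodDrops e (g n) (k n) (per n) (r n)) :
    ∃ n, (g n).1 = emptyMP l ∧ (g n).2 ∈ Tle l e := by
  have hg' : ∀ n, g n = dropRows (g 0) fun c => ∑ m ∈ Finset.range n, r m c := by
    intro n
    induction n with
    | zero => simp [dropRows]
    | succ n ih =>
      rw [hg n, ih]
      simp only [dropRows, Finset.sum_range_succ, Prod.mk.injEq]
      refine ⟨?_, ?_⟩
      · ext c i
        exact congrArg _ (by ring)
      · ext c
        push_cast
        ring
  have hmono : ∀ c, Monotone fun n => ∑ m ∈ Finset.range n, r m c := fun c =>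
    monotone_nat_of_le_succ fun n => by simp [Finset.sum_range_succ]
  have hlarge : ∀ M : Fin l → ℕ, ∃ N, ∀ n, N ≤ n → ∀ c, M c ≤ ∑ m ∈ Finset.range n, r m c := by
    intro M
    choose N hN using fun c => exists_le_sum_of_periodDrops he h0 hg' hr c (M c)
    exact ⟨Finset.univ.sup N, fun n hn c =>
      (hN c).trans (hmono c ((Finset.le_sup (Finset.mem_univ c)).trans hn))⟩
  choose Z hZ using h0.2
  obtain ⟨N, hN⟩ := hlarge Z
  have hempty : ∀ n, N ≤ n → (g n).1 = emptyMP l := by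
    intro n hn
    rw [hg' n]
    ext c i
    exact hZ c _ ((hN n hn c).trans (Nat.le_add_left _ _))
  have hmax : ∀ n, N ≤ n → (∃ c, k n ≤ (g n).2 c) ∧ ∀ c, (g n).2 c ≤ k n := by
    intro n hn
    have := (hr n).1.1
    rw [hempty n hn] at this
    simp only [IsMaxEntry, rowHas_emptyMP] at this
    exact ⟨this.1, fun c => this.2 c _ le_rfl⟩
  obtain ⟨n, hn⟩ := exists_mem_Tle_of_le_iff (e := e) (fun n => (g (N + n)).2)
    (fun n => k (N + n)) (fun n => hmax (N + n) (by omega))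
    (fun n c v => by
      simp only [← add_assoc]
      rw [hg (N + n)]
      exact (hr (N + n)).le_iff_of_empty (hempty _ (by omega)) c v)
    (fun K => by
      obtain ⟨n, hn⟩ := hlarge fun c => ((g 0).2 c - K).toNat
      refine ⟨n, ?_⟩
      obtain ⟨c, hc⟩ := (hmax (N + n) (by omega)).1
      have h1 := hn (N + n) (by omega) c
      rw [hg' (N + n)] at hc
      simp only [dropRows] at hc
      omega)
  exact ⟨N + n, hempty _ (by omega), hn⟩

/-- One peeling step on pairs: delete the period if there is one. -/
lemma exists_peeling_step (l e : ℕ) : ∃ F : MP l × Charge l → MP l × Charge l,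
    ∀ x, IsLPartition x.1 → IsLPartition (F x).1 ∧
      (EPeriodic e x.1 x.2 → ∃ k per r, PeriodDrops e x k per r ∧ F x = dropRows x r) := by
  suffices ∀ x : MP l × Charge l, ∃ y : MP l × Charge l, IsLPartition x.1 → IsLPartition y.1 ∧
      (EPeriodic e x.1 x.2 → ∃ k per r, PeriodDrops e x k per r ∧ y = dropRows x r) by
    choose F hF using this
    exact ⟨F, hF⟩
  intro x
  by_cases h : IsLPartition x.1 ∧ EPeriodic e x.1 x.2
  · obtain ⟨hx, k, per, hper⟩ := h
    obtain ⟨r, hr⟩ := hper.exists_periodDrops hx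
    exact ⟨dropRows x r, fun _ => ⟨hx.dropRows r, fun _ => ⟨k, per, r, hr, rfl⟩⟩⟩
  · exact ⟨x, fun hx => ⟨hx, fun hper => absurd ⟨hx, hper⟩ h⟩⟩

/-- the peeling procedure terminates, and if it ends with the empty
`l`-partition then the final multicharge lies in `T_{l,e}`. -/
theorem peeling_terminates {l e : ℕ} (hl : 0 < l) (he : 2 ≤ e)
    (P : MP l) (s : Charge l) (hP : IsLPartition P) :
    ∃ (n : ℕ) (g : ℕ → MP l × Charge l), g 0 = (P, s) ∧
      (∀ m, m < n →
        ¬(¬ EPeriodic e (g m).1 (g m).2 ∨ ((g m).1 = emptyMP l ∧ (g m).2 ∈ Tle l e)) ∧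
        DeletesTo e (g m).1 (g m).2 (g (m + 1)).1 (g (m + 1)).2) ∧
      (¬ EPeriodic e (g n).1 (g n).2 ∨ ((g n).1 = emptyMP l ∧ (g n).2 ∈ Tle l e)) ∧
      ((g n).1 = emptyMP l → (g n).2 ∈ Tle l e) := by
  obtain ⟨F, hF⟩ := exists_peeling_step l e
  let g : ℕ → MP l × Charge l := fun n => F^[n] (P, s)
  have hsucc : ∀ n, g (n + 1) = F (g n) := fun n => Function.iterate_succ_apply' F n _
  have hpart : ∀ n, IsLPartition (g n).1 := by
    intro n
    induction n with
    | zero => exact hP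
    | succ n ih => rw [hsucc]; exact (hF _ ih).1
  have hterm : ∃ n, ¬ EPeriodic e (g n).1 (g n).2 ∨
      ((g n).1 = emptyMP l ∧ (g n).2 ∈ Tle l e) := by
    by_contra! hcon
    choose k per r hr hgr using fun n => (hF _ (hpart n)).2 (hcon n).1
    obtain ⟨n, hn, hn'⟩ := exists_empty_of_periodDrops (by omega) (hpart 0)
      (fun n => (hsucc n).trans (hgr n)) hr
    exact (hcon n).2 hn hn'
  refine ⟨Nat.find hterm, g, rfl, fun m hm => ⟨Nat.find_min hterm hm, ?_⟩,
    Nat.find_spec hterm, fun hempty => ?_⟩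
  · have hper := not_not.1 (not_or.1 (Nat.find_min hterm hm)).1
    obtain ⟨k, per, r, hr, hgr⟩ := (hF _ (hpart m)).2 hper
    rw [hsucc, hgr]
    exact hr.deletesTo (hpart m)
  · rcases Nat.find_spec hterm with h | h
    · rw [hempty] at h
      exact absurd (ePeriodic_emptyMP e hl _) h
    · exact h.2

end FockHW
end
end

section
/- Let λ be an l-partition, s ∈ ℤ^l and i ∈ ℤ/eℤ. Let j_low be the largest integer congruent to i mod e such that every row of B(λ,s) contains every integer ≤ j_low. For each integer j ≡ i (mod e) with j ≥ j_low, let u_j be the word obtained by reading the entries of B(λ,s) equal to j or j+1, going through the rows from top (row l−1) to bottom (row 0) and through each row from right to left, and let u_i be the concatenation u_{j_low} u_{j_low+e} u_{j_low+2e} ⋯ (a finite word). Encode each letter of u_i congruent to i mod e by A and each letter congruent to i+1 mod e by R, and recursively delete all factors RA. Then the resulting word equals A^{φ_i(λ)} R^{ε_i(λ)}, the reduced i-word of λ. -/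
/- Formalization of combinatorial notions from
   "A combinatorial decomposition of higher level Fock spaces"
   by N. Jacon and C. Lecouvey. -/

open scoped Classical

noncomputable section

namespace FockHW

/-- The state `(p, q)` records a prefix of length `n` of a walk with partial sums `S`:
its current height is `p - q` and its maximal height so far is `p`. -/
def WalkState (S : ℕ → ℤ) (n : ℕ) (st : ℕ × ℕ) : Prop :=
  (st.1 : ℤ) - st.2 = S n ∧ IsGreatest {z : ℤ | ∃ m ≤ n, z = S m} st.1

/-- `w` is one of the words `∅`, `A`, `R`, `RA`, with `#A - #R = d`. -/
def IsLetterBlock (w : List Bool) (d : ℤ) : Prop :=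
  (w = [] ∧ d = 0) ∨ (w = [true] ∧ d = 1) ∨ (w = [false] ∧ d = -1) ∨
    (w = [false, true] ∧ d = 0)

lemma walkState_succ {S : ℕ → ℤ} {n : ℕ} {st st' : ℕ × ℕ} (h : WalkState S n st)
    (hheight : (st'.1 : ℤ) - st'.2 = S (n + 1))
    (hmax : (st'.1 : ℤ) = max (st.1 : ℤ) (S (n + 1))) : WalkState S (n + 1) st' := by
  obtain ⟨-, ⟨m, hm, hmS⟩, hub⟩ := h
  refine ⟨hheight, ?_, ?_⟩
  · rcases max_choice (st.1 : ℤ) (S (n + 1)) with hc | hc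
    · exact ⟨m, by omega, by rw [hmax, hc, hmS]⟩
    · exact ⟨n + 1, le_rfl, by rw [hmax, hc]⟩
  · rintro z ⟨k, hk, rfl⟩
    rw [hmax]
    rcases Nat.lt_or_ge n k with hlt | hle
    · obtain rfl : k = n + 1 := by omega
      exact le_max_right _ _
    · exact le_max_of_le_left (hub ⟨k, hle, rfl⟩)

lemma walkState_letterBlock {S : ℕ → ℤ} {n : ℕ} {st : ℕ × ℕ} {w : List Bool}
    (h : WalkState S n st) (hw : IsLetterBlock w (S (n + 1) - S n)) :
    WalkState S (n + 1) (w.foldl reduceStep st) := by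
  obtain ⟨p, q⟩ := st
  have hh := h.1
  simp only at hh
  rcases hw with ⟨rfl, hd⟩ | ⟨rfl, hd⟩ | ⟨rfl, hd⟩ | ⟨rfl, hd⟩
  · apply walkState_succ h <;> simp <;> omega
  · by_cases hq : q = 0
    · subst hq
      apply walkState_succ h <;> simp [reduceStep] <;> omega
    · apply walkState_succ h <;> simp [reduceStep, hq] <;> omega
  · apply walkState_succ h <;> simp [reduceStep] <;> omega
  · apply walkState_succ h <;> simp [reduceStep] <;> omega

lemma walkState_flatten {S : ℕ → ℤ} (L : List (List Bool)) {n : ℕ} {st : ℕ × ℕ}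
    (h : WalkState S n st)
    (hL : ∀ (k : ℕ) (hk : k < L.length), IsLetterBlock L[k] (S (n + k + 1) - S (n + k))) :
    WalkState S (n + L.length) (L.flatten.foldl reduceStep st) := by
  induction L generalizing n st with
  | nil => simpa using h
  | cons w L ih =>
    have h1 : WalkState S (n + 1) (w.foldl reduceStep st) :=
      walkState_letterBlock h (hL 0 (by simp))
    have h2 := ih h1 fun k hk => by
      have := hL (k + 1) (by simpa using hk)
      simpa [Nat.add_assoc, Nat.add_comm 1] using this
    simpa [List.foldl_append, Nat.add_assoc, Nat.add_comm 1] using h2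

/-- The contribution to `#A - #R` of content `x` in component `c`. -/
def nodeSign {l : ℕ} (P : MP l) (s : Charge l) (x : ℤ) (c : Fin l) : ℤ :=
  addA P s c x - remR P s c x

/-- The contribution to `#A - #R` of the `k`-th position of the word `u_i`. -/
def positionSign {l : ℕ} (hl : 0 < l) (e : ℕ) (P : MP l) (s : Charge l) (jlow : ℤ) (k : ℕ) : ℤ :=
  nodeSign P s (jlow + ((k / l : ℕ) : ℤ) * (e : ℤ)) (Fin.rev ⟨k % l, Nat.mod_lt _ hl⟩)

/-- The value of `#A - #R` over the first `n` positions of the word `u_i`. -/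
def heightSum {l : ℕ} (hl : 0 < l) (e : ℕ) (P : MP l) (s : Charge l) (jlow : ℤ) (n : ℕ) : ℤ :=
  ∑ k ∈ Finset.range n, positionSign hl e P s jlow k

lemma isLetterBlock_nodeSign {l : ℕ} (P : MP l) (s : Charge l) (x : ℤ) (c : Fin l) :
    IsLetterBlock ((if RowHas P s c (x + 1) then [false] else []) ++
      (if RowHas P s c x then [true] else [])) (nodeSign P s x c) := by
  by_cases h1 : RowHas P s c (x + 1) <;> by_cases h0 : RowHas P s c x <;>
    simp [IsLetterBlock, nodeSign, addA, remR, h0, h1]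

lemma positionSign_mul_add {l : ℕ} (hl : 0 < l) (e : ℕ) (P : MP l) (s : Charge l) (jlow : ℤ)
    (t r : ℕ) (hr : r < l) :
    positionSign hl e P s jlow (t * l + r) =
      nodeSign P s (jlow + (t : ℤ) * (e : ℤ)) (Fin.rev ⟨r, hr⟩) := by
  have h1 : (t * l + r) / l = t := by
    rw [Nat.add_comm, Nat.add_mul_div_right _ _ hl, Nat.div_eq_of_lt hr, Nat.zero_add]
  have h2 : (t * l + r) % l = r := by
    rw [Nat.add_comm, Nat.add_mul_mod_self_right, Nat.mod_eq_of_lt hr]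
  simp only [positionSign, h1, h2]

lemma walkState_uiWord {l : ℕ} (hl : 0 < l) (e : ℕ) (P : MP l) (s : Charge l) (jlow : ℤ)
    (B : ℕ) :
    WalkState (heightSum hl e P s jlow) (B * l) (reduceRA (uiWord e P s jlow B)) := by
  induction B with
  | zero =>
    refine ⟨by simp [reduceRA, uiWord, heightSum], ⟨0, by simp, ?_⟩, ?_⟩
    · simp [reduceRA, uiWord, heightSum]
    · rintro z ⟨m, hm, rfl⟩
      obtain rfl : m = 0 := by omega
      simp [reduceRA, uiWord, heightSum]
  | succ B ih =>
    have hword : reduceRA (uiWord e P s jlow (B + 1)) =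
        (ujWord P s (jlow + (B : ℤ) * (e : ℤ))).foldl reduceStep
          (reduceRA (uiWord e P s jlow B)) := by
      simp [reduceRA, uiWord, List.range_succ, List.foldl_append]
    rw [hword]
    have h := walkState_flatten ((List.finRange l).reverse.map (fun c =>
      (if RowHas P s c (jlow + (B : ℤ) * (e : ℤ) + 1) then [false] else []) ++
      (if RowHas P s c (jlow + (B : ℤ) * (e : ℤ)) then [true] else []))) ih ?_
    · simpa [Nat.add_mul, ujWord] using h
    · intro k hk
      have hk' : k < l := by simpa using hk
      have hsucc : heightSum hl e P s jlow (B * l + k + 1) - heightSum hl e P s jlow (B * l + k) =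
          nodeSign P s (jlow + (B : ℤ) * (e : ℤ)) (Fin.rev ⟨k, hk'⟩) := by
        rw [heightSum, heightSum, Finset.sum_range_succ, positionSign_mul_add hl e P s jlow B k hk']
        ring
      rw [hsucc]
      have hget : ((List.finRange l).reverse)[k]'(by simpa using hk') = Fin.rev ⟨k, hk'⟩ := by
        simp only [List.getElem_reverse, List.getElem_finRange]
        ext
        simp [Fin.val_rev]
        omega
      rw [List.getElem_map, hget]
      exact isLetterBlock_nodeSign _ _ _ _

lemma heightSum_mul_add {l : ℕ} (hl : 0 < l) (e : ℕ) (P : MP l) (s : Charge l) (jlow : ℤ)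
    (t m : ℕ) (hm : m ≤ l) :
    heightSum hl e P s jlow (t * l + m) = heightSum hl e P s jlow (t * l) +
      ∑ c ∈ Finset.univ.filter (fun c : Fin l => l ≤ (c : ℕ) + m),
        nodeSign P s (jlow + (t : ℤ) * (e : ℤ)) c := by
  rw [heightSum, heightSum, Finset.sum_range_add]
  congr 1
  refine Finset.sum_bij' (fun k _ => Fin.rev ⟨k % l, Nat.mod_lt _ hl⟩)
    (fun c _ => l - 1 - (c : ℕ)) ?_ ?_ ?_ ?_ ?_
  · intro k hk
    rw [Finset.mem_range] at hk
    have hk' : k % l = k := Nat.mod_eq_of_lt (by omega)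
    simp only [Finset.mem_filter, Finset.mem_univ, true_and, Fin.val_rev, hk']
    omega
  · intro c hc
    simp only [Finset.mem_filter, Finset.mem_univ, true_and] at hc
    rw [Finset.mem_range]
    omega
  · intro k hk
    rw [Finset.mem_range] at hk
    have hk' : k % l = k := Nat.mod_eq_of_lt (by omega)
    simp only [Fin.val_rev, hk']
    omega
  · intro c hc
    have hc' : (l - 1 - (c : ℕ)) % l = l - 1 - (c : ℕ) := Nat.mod_eq_of_lt (by omega)
    ext
    simp only [Fin.val_rev, hc']
    omega
  · intro k hk
    rw [Finset.mem_range] at hk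
    have hk' : k < l := by omega
    rw [positionSign_mul_add hl e P s jlow t k hk']
    congr 2
    ext
    simp [Nat.mod_eq_of_lt hk']

lemma heightSum_mul {l : ℕ} (hl : 0 < l) (e : ℕ) (P : MP l) (s : Charge l) (jlow : ℤ) (t : ℕ) :
    heightSum hl e P s jlow (t * l) =
      ∑ t' ∈ Finset.range t, ∑ c, nodeSign P s (jlow + (t' : ℤ) * (e : ℤ)) c := by
  induction t with
  | zero => simp [heightSum]
  | succ t ih =>
    rw [Nat.add_mul, Nat.one_mul, heightSum_mul_add hl e P s jlow t l le_rfl, ih,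
      Finset.sum_range_succ]
    congr 1
    rw [Finset.filter_true_of_mem (by simp)]

lemma prefInf_eq {l : ℕ} (P : MP l) (s : Charge l) (x : ℤ) (c₀ : Fin l) :
    prefInf P s x c₀ =
      ∑ c ∈ Finset.univ.filter (fun c : Fin l => l ≤ (c : ℕ) + (l - c₀)), nodeSign P s x c := by
  unfold prefInf nodeSign
  refine Finset.sum_congr ?_ fun _ _ => rfl
  ext c
  simp only [Finset.mem_filter, Finset.mem_univ, true_and, Fin.le_def]
  omega

lemma suffInf_add_sum {l : ℕ} (P : MP l) (s : Charge l) (x : ℤ) (c₀ : Fin l) :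
    suffInf P s x c₀ + ∑ c, nodeSign P s x c =
      ∑ c ∈ Finset.univ.filter (fun c : Fin l => l ≤ (c : ℕ) + (l - 1 - c₀)),
        nodeSign P s x c := by
  have hneg : suffInf P s x c₀ =
      -∑ c ∈ Finset.univ.filter (fun c : Fin l => c ≤ c₀), nodeSign P s x c := by
    unfold suffInf nodeSign
    rw [← Finset.sum_neg_distrib]
    exact Finset.sum_congr rfl fun _ _ => by ring
  rw [hneg, ← Finset.sum_filter_add_sum_filter_not Finset.univ (fun c : Fin l => c ≤ c₀),
    neg_add_cancel_left]
  refine Finset.sum_congr ?_ fun _ _ => rfl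
  ext c
  simp only [Finset.mem_filter, Finset.mem_univ, true_and, Fin.le_def]
  omega

lemma sum_range_of_eq_of_eq_zero {B t : ℕ} (ht : t < B) {G T : ℕ → ℤ}
    (hlt : ∀ k < t, G k = T k) (hgt : ∀ k, t < k → G k = 0) :
    ∑ k ∈ Finset.range B, G k = ∑ k ∈ Finset.range t, T k + G t := by
  rw [← Finset.sum_subset (Finset.range_subset_range.2 (Nat.succ_le_of_lt ht)),
    Finset.sum_range_succ, Finset.sum_congr rfl fun k hk => hlt k (Finset.mem_range.1 hk)]
  intro k _ hk
  exact hgt k (by simpa using hk)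

/-- A sum over the contents congruent to `i` whose terms vanish outside the window
`[jlow, jlow + B e)` is a sum over the progression `jlow + t e`, `t < B`. -/
lemma finsum_residue {e : ℕ} (he : 0 < e) {i : ZMod e} {jlow : ℤ} (hres : (jlow : ZMod e) = i)
    (B : ℕ) (H : ℤ → ℤ) (hlow : ∀ x < jlow, H x = 0)
    (hhigh : ∀ x, jlow + (B : ℤ) * (e : ℤ) ≤ x → H x = 0) :
    (∑ᶠ x : ℤ, if (x : ZMod e) = i then H x else 0) =
      ∑ t ∈ Finset.range B, H (jlow + (t : ℤ) * (e : ℤ)) := by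
  have he' : (0 : ℤ) < e := by exact_mod_cast he
  rw [finsum_eq_sum_of_support_subset (s := (Finset.range B).image
    (fun t : ℕ => jlow + (t : ℤ) * (e : ℤ))), Finset.sum_image]
  · refine Finset.sum_congr rfl fun t _ => if_pos ?_
    simp [hres]
  · intro a _ b _ hab
    have hab' : (a : ℤ) * e = b * e := by simpa using hab
    exact_mod_cast mul_right_cancel₀ he'.ne' hab'
  · intro x hx
    rw [Function.mem_support] at hx
    have hxi : (x : ZMod e) = i := by
      by_contra h
      simp [h] at hx
    rw [if_pos hxi] at hx
    have h1 : jlow ≤ x := by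
      by_contra! h
      exact hx (hlow x h)
    have h2 : x < jlow + (B : ℤ) * (e : ℤ) := by
      by_contra! h
      exact hx (hhigh x h)
    obtain ⟨k, hk⟩ := (ZMod.intCast_eq_intCast_iff_dvd_sub jlow x e).1 (hres.trans hxi.symm)
    have hk0 : 0 ≤ k := by
      by_contra! h
      nlinarith
    have hkB : k < B := by
      by_contra! h
      nlinarith
    lift k to ℕ using hk0
    simp only [Finset.coe_image, Set.mem_image, Finset.coe_range, Set.mem_Iio]
    exact ⟨k, by exact_mod_cast hkB, by linarith [mul_comm (e : ℤ) k]⟩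

section Window

variable {l e : ℕ} (hl : 0 < l) {P : MP l} {s : Charge l} {i : ZMod e}
  {jlow : ℤ} {B : ℕ}

/-- The nodes of content `x` exist only inside the window `[jlow, jlow + B e)`. -/
def Windowed (e : ℕ) (P : MP l) (s : Charge l) (jlow : ℤ) (B : ℕ) : Prop :=
  ∀ x c, (x < jlow ∨ jlow + (B : ℤ) * (e : ℤ) ≤ x) → addA P s c x = 0 ∧ remR P s c x = 0

lemma prefE_eq_sum (he : 0 < e) (hres : (jlow : ZMod e) = i) (hW : Windowed e P s jlow B)
    (x₀ : ℤ) (c₀ : Fin l) :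
    prefE e P s i x₀ c₀ = ∑ t ∈ Finset.range B,
      (if jlow + (t : ℤ) * (e : ℤ) < x₀ then ∑ c, nodeSign P s (jlow + (t : ℤ) * (e : ℤ)) c
       else if jlow + (t : ℤ) * (e : ℤ) = x₀ then
        prefInf P s (jlow + (t : ℤ) * (e : ℤ)) c₀ else 0) := by
  have hzero : ∀ x, (x < jlow ∨ jlow + (B : ℤ) * (e : ℤ) ≤ x) →
      (if x < x₀ then ∑ c : Fin l, (addA P s c x - remR P s c x)
       else if x = x₀ then prefInf P s x c₀ else 0) = 0 := by
    intro x hx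
    have h := fun c => hW x c hx
    simp [prefInf, fun c => (h c).1, fun c => (h c).2]
  exact finsum_residue he hres B _ (fun x hx => hzero x (Or.inl hx))
    (fun x hx => hzero x (Or.inr hx))

lemma suffE_eq_sum (he : 0 < e) (hres : (jlow : ZMod e) = i) (hW : Windowed e P s jlow B)
    (x₀ : ℤ) (c₀ : Fin l) :
    suffE e P s i x₀ c₀ = ∑ t ∈ Finset.range B,
      (if x₀ < jlow + (t : ℤ) * (e : ℤ) then -∑ c, nodeSign P s (jlow + (t : ℤ) * (e : ℤ)) c
       else if jlow + (t : ℤ) * (e : ℤ) = x₀ then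
        suffInf P s (jlow + (t : ℤ) * (e : ℤ)) c₀ else 0) := by
  have hzero : ∀ x, (x < jlow ∨ jlow + (B : ℤ) * (e : ℤ) ≤ x) →
      (if x₀ < x then ∑ c : Fin l, (remR P s c x - addA P s c x)
       else if x = x₀ then suffInf P s x c₀ else 0) = 0 := by
    intro x hx
    have h := fun c => hW x c hx
    simp [suffInf, fun c => (h c).1, fun c => (h c).2]
  have h := finsum_residue he hres B _ (fun x hx => hzero x (Or.inl hx))
    (fun x hx => hzero x (Or.inr hx))
  refine h.trans (Finset.sum_congr rfl fun t _ => ?_)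
  simp only [nodeSign, ← Finset.sum_neg_distrib, neg_sub]

/-- The value of `suffE` plus the total height has the shape of a prefix sum. -/
lemma suffE_add_heightSum (he : 0 < e) (hres : (jlow : ZMod e) = i)
    (hW : Windowed e P s jlow B) (x₀ : ℤ) (c₀ : Fin l) :
    suffE e P s i x₀ c₀ + heightSum hl e P s jlow (B * l) = ∑ t ∈ Finset.range B,
      (if jlow + (t : ℤ) * (e : ℤ) < x₀ then ∑ c, nodeSign P s (jlow + (t : ℤ) * (e : ℤ)) c
       else if jlow + (t : ℤ) * (e : ℤ) = x₀ then
        ∑ c ∈ Finset.univ.filter (fun c : Fin l => l ≤ (c : ℕ) + (l - 1 - c₀)),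
          nodeSign P s (jlow + (t : ℤ) * (e : ℤ)) c else 0) := by
  rw [suffE_eq_sum he hres hW, heightSum_mul, ← Finset.sum_add_distrib]
  refine Finset.sum_congr rfl fun t _ => ?_
  rw [← suffInf_add_sum]
  rcases lt_trichotomy (jlow + (t : ℤ) * (e : ℤ)) x₀ with h | h | h
  · simp [h, h.not_gt, h.ne]
  · simp [h]
  · simp [h, h.not_gt, h.ne']

/-- The sum over all nodes of content below `x₀`, completed by `m` nodes at `x₀`, is a height. -/
lemma sum_at_progression (he : 0 < e) {t₀ : ℕ} (ht : t₀ < B) {m : ℕ} (hm : m ≤ l) :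
    ∑ t ∈ Finset.range B,
      (if jlow + (t : ℤ) * (e : ℤ) < jlow + (t₀ : ℤ) * (e : ℤ) then
        ∑ c, nodeSign P s (jlow + (t : ℤ) * (e : ℤ)) c
       else if jlow + (t : ℤ) * (e : ℤ) = jlow + (t₀ : ℤ) * (e : ℤ) then
        ∑ c ∈ Finset.univ.filter (fun c : Fin l => l ≤ (c : ℕ) + m),
          nodeSign P s (jlow + (t : ℤ) * (e : ℤ)) c else 0) =
    heightSum hl e P s jlow (t₀ * l + m) := by
  have he' : (0 : ℤ) < e := by exact_mod_cast he
  have hlt : ∀ k k' : ℕ, k < k' →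
      jlow + (k : ℤ) * (e : ℤ) < jlow + (k' : ℤ) * (e : ℤ) := fun k k' hk => by
    have : (k : ℤ) < k' := by exact_mod_cast hk
    nlinarith
  rw [heightSum_mul_add hl e P s jlow t₀ m hm, heightSum_mul,
    sum_range_of_eq_of_eq_zero ht (fun k hk => if_pos (hlt k t₀ hk))
      (fun k hk => by simp [(hlt t₀ k hk).not_gt, (hlt t₀ k hk).ne'])]
  simp

lemma exists_sum_eq_heightSum (he : 0 < e) (x₀ : ℤ) {m : ℕ} (hm : m ≤ l) :
    ∃ n ≤ B * l, ∑ t ∈ Finset.range B,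
      (if jlow + (t : ℤ) * (e : ℤ) < x₀ then
        ∑ c, nodeSign P s (jlow + (t : ℤ) * (e : ℤ)) c
       else if jlow + (t : ℤ) * (e : ℤ) = x₀ then
        ∑ c ∈ Finset.univ.filter (fun c : Fin l => l ≤ (c : ℕ) + m),
          nodeSign P s (jlow + (t : ℤ) * (e : ℤ)) c else 0) =
    heightSum hl e P s jlow n := by
  by_cases hx : ∃ t₀ < B, x₀ = jlow + (t₀ : ℤ) * (e : ℤ)
  · obtain ⟨t₀, ht₀, rfl⟩ := hx
    refine ⟨t₀ * l + m, ?_, sum_at_progression hl he ht₀ hm⟩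
    nlinarith
  · push Not at hx
    have hex : ∃ t : ℕ, B ≤ t ∨ x₀ ≤ jlow + (t : ℤ) * (e : ℤ) := ⟨B, Or.inl le_rfl⟩
    have hB : Nat.find hex ≤ B := Nat.find_min' hex (Or.inl le_rfl)
    refine ⟨Nat.find hex * l, Nat.mul_le_mul_right l hB, ?_⟩
    rw [heightSum_mul, ← Finset.sum_subset (Finset.range_subset_range.2 hB)]
    · refine Finset.sum_congr rfl fun t ht => if_pos ?_
      have := Nat.find_min hex (Finset.mem_range.1 ht)
      push Not at this
      exact this.2
    · intro t ht ht'
      rw [Finset.mem_range] at ht ht'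
      rw [if_neg, if_neg (hx t ht).symm]
      rcases Nat.find_spec hex with h | h
      · omega
      · have : ((Nat.find hex : ℕ) : ℤ) ≤ t := by exact_mod_cast not_lt.1 ht'
        have he' : (0 : ℤ) < e := by exact_mod_cast he
        nlinarith

lemma prefE_set_eq (he : 0 < e) (hres : (jlow : ZMod e) = i) (hW : Windowed e P s jlow B) :
    insert 0 {z : ℤ | ∃ x₀ c₀, z = prefE e P s i x₀ c₀} =
      {z : ℤ | ∃ m ≤ B * l, z = heightSum hl e P s jlow m} := by
  ext z
  constructor
  · rintro (rfl | ⟨x₀, c₀, rfl⟩)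
    · exact ⟨0, Nat.zero_le _, by simp [heightSum]⟩
    · rw [prefE_eq_sum he hres hW]
      simp only [prefInf_eq]
      exact exists_sum_eq_heightSum hl he x₀ (Nat.sub_le _ _)
  · rintro ⟨m, hm, rfl⟩
    rcases m with _ | k
    · exact Or.inl (by simp [heightSum])
    · have hr := Nat.mod_lt k hl
      refine Or.inr ⟨jlow + ((k / l : ℕ) : ℤ) * (e : ℤ), Fin.rev ⟨k % l, hr⟩, ?_⟩
      rw [prefE_eq_sum he hres hW]
      simp only [prefInf_eq]
      rw [sum_at_progression hl he ((Nat.div_lt_iff_lt_mul hl).2 (by omega)) (Nat.sub_le _ _)]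
      have := Nat.div_add_mod' k l
      congr 1
      simp only [Fin.val_rev]
      omega

lemma suffE_set_eq (he : 0 < e) (hres : (jlow : ZMod e) = i) (hW : Windowed e P s jlow B) :
    insert 0 {z : ℤ | ∃ x₀ c₀, z = suffE e P s i x₀ c₀} =
      {z : ℤ | ∃ m ≤ B * l,
        z = heightSum hl e P s jlow m - heightSum hl e P s jlow (B * l)} := by
  ext z
  constructor
  · rintro (rfl | ⟨x₀, c₀, rfl⟩)
    · exact ⟨B * l, le_rfl, by simp⟩
    · obtain ⟨n, hn, h⟩ := exists_sum_eq_heightSum (P := P) (s := s) (jlow := jlow) (B := B)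
        hl he x₀ (show l - 1 - (c₀ : ℕ) ≤ l by omega)
      exact ⟨n, hn, by rw [← h, ← suffE_add_heightSum hl he hres hW, add_sub_cancel_right]⟩
  · rintro ⟨k, hk, rfl⟩
    rcases hk.eq_or_lt with rfl | hk
    · exact Or.inl (by simp)
    · have hr := Nat.mod_lt k hl
      refine Or.inr ⟨jlow + ((k / l : ℕ) : ℤ) * (e : ℤ), Fin.rev ⟨k % l, hr⟩, ?_⟩
      rw [eq_comm, eq_sub_iff_add_eq, suffE_add_heightSum hl he hres hW,
        sum_at_progression hl he ((Nat.div_lt_iff_lt_mul hl).2 hk) (by omega)]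
      have := Nat.div_add_mod' k l
      congr 1
      simp only [Fin.val_rev]
      omega

end Window

/-- the `RA`-reduction of the word `u_i` read from the symbol equals
the reduced `i`-word `A^{φ_i(λ)} R^{ε_i(λ)}` of `λ`. -/
theorem reduce_uiWord_eq_reduced_word {l e : ℕ} (hl : 0 < l) (he : 2 ≤ e)
    (P : MP l) (s : Charge l) (hP : IsLPartition P) (i : ZMod e)
    (jlow : ℤ) (hjlow_res : (jlow : ZMod e) = i)
    (hjlow_all : ∀ (c : Fin l) (v : ℤ), v ≤ jlow → RowHas P s c v)
    (hjlow_max : ∀ j' : ℤ, jlow < j' → (j' : ZMod e) = i →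
      ¬ ∀ (c : Fin l) (v : ℤ), v ≤ j' → RowHas P s c v)
    (B : ℕ) (hB : ∀ (c : Fin l) (v : ℤ), RowHas P s c v → v < jlow + (B : ℤ) * (e : ℤ)) :
    ((reduceRA (uiWord e P s jlow B)).1 : ℤ) = phiE e P s i ∧
    ((reduceRA (uiWord e P s jlow B)).2 : ℤ) = epsE e P s i := by
  have he0 : 0 < e := by omega
  have hW : Windowed e P s jlow B := by
    rintro x c (hx | hx)
    · have h0 := hjlow_all c x (by omega)
      have h1 := hjlow_all c (x + 1) (by omega)
      simp [addA, remR, h0, h1]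
    · have h0 : ¬ RowHas P s c x := fun h => (hB c x h).not_ge hx
      have h1 : ¬ RowHas P s c (x + 1) := fun h => by
        have := hB c (x + 1) h
        omega
      simp [addA, remR, h0, h1]
  obtain ⟨hheight, hmax⟩ := walkState_uiWord hl e P s jlow B
  constructor
  · rw [phiE, prefE_set_eq hl he0 hjlow_res hW]
    exact hmax.csSup_eq.symm
  · rw [epsE, suffE_set_eq hl he0 hjlow_res hW]
    refine (IsGreatest.csSup_eq ⟨?_, ?_⟩).symm
    · obtain ⟨m, hm, h⟩ := hmax.1
      exact ⟨m, hm, by omega⟩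
    · rintro z ⟨m, hm, rfl⟩
      have := hmax.2 ⟨m, hm, rfl⟩
      omega

end FockHW
end
end

section
/- Let e ≥ 2, s ∈ ℤ^l, i ∈ ℤ/eℤ, and let λ be an l-partition with φ_i(λ) > 0; let γ be the good addable i-node of λ (with respect to residues mod e) and j = cont(γ) ∈ ℤ. Then φ^∞_j(λ) > 0 and γ is the good addable j-node of λ for the e = ∞ structure. (In other words, every arrow λ → μ = λ ∪ {γ} of the crystal G_{e,s} is also an arrow of the crystal G_{∞,s}, with color the content of γ.) -/
/- Formalization of combinatorial notions from
   "A combinatorial decomposition of higher level Fock spaces"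
   by N. Jacon and C. Lecouvey. -/

open scoped Classical

noncomputable section

namespace FockHW

/-- `#A - #R` over all nodes of content `x`. -/
def contentWt {l : ℕ} (P : MP l) (s : Charge l) (x : ℤ) : ℤ :=
  ∑ c : Fin l, (addA P s c x - remR P s c x)

/-- `#A - #R` over all `i`-nodes of content strictly less than `x`. -/
def belowWt {l : ℕ} (e : ℕ) (P : MP l) (s : Charge l) (i : ZMod e) (x : ℤ) : ℤ :=
  ∑ᶠ y : ℤ, if (y : ZMod e) = i ∧ y < x then contentWt P s y else 0

lemma remR_nonneg {l : ℕ} (P : MP l) (s : Charge l) (c : Fin l) (x : ℤ) : 0 ≤ remR P s c x := by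
  unfold remR; split_ifs <;> simp

lemma addA_eq_zero_of_ne_one {l : ℕ} {P : MP l} {s : Charge l} {c : Fin l} {x : ℤ}
    (h : addA P s c x ≠ 1) : addA P s c x = 0 := by
  unfold addA at *; split_ifs at * <;> simp_all

lemma finite_support_addA_sub_remR {l : ℕ} {P : MP l} (s : Charge l) (hP : IsLPartition P)
    (c : Fin l) : (Function.support fun x => addA P s c x - remR P s c x).Finite := by
  obtain ⟨N, hN⟩ := hP.2 c
  have low : ∀ v : ℤ, v ≤ s c - N → RowHas P s c v := by
    intro v hv
    refine ⟨(s c - v).toNat, ?_⟩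
    have : P c (s c - v).toNat = 0 := hN _ (by omega)
    simp only [symb, this]
    omega
  have high : ∀ v : ℤ, RowHas P s c v → v ≤ P c 0 + s c := by
    rintro v ⟨k, rfl⟩
    have : P c k ≤ P c 0 := hP.1 c (Nat.zero_le k)
    simp only [symb]
    omega
  refine (Set.finite_Icc (s c - N) (P c 0 + s c)).subset fun x hx => ?_
  by_contra hmem
  apply hx
  have hcase : x < s c - N ∨ P c 0 + s c < x := by
    by_contra h
    push Not at h
    exact hmem ⟨h.1, h.2⟩
  rcases hcase with h | h
  · have h₁ := low x (by omega)
    have h₂ := low (x + 1) (by omega)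
    simp [addA, remR, h₁, h₂]
  · have h₁ : ¬ RowHas P s c x := fun hr => by have := high _ hr; omega
    have h₂ : ¬ RowHas P s c (x + 1) := fun hr => by have := high _ hr; omega
    simp [addA, remR, h₁, h₂]

lemma finite_support_contentWt {l : ℕ} {P : MP l} (s : Charge l) (hP : IsLPartition P) :
    (Function.support (contentWt P s)).Finite := by
  refine (Set.finite_iUnion fun c => finite_support_addA_sub_remR s hP c).subset fun x hx => ?_
  by_contra h
  simp only [Set.mem_iUnion, Function.mem_support, not_exists, not_not] at h
  exact hx (Finset.sum_eq_zero fun c _ => h c)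

lemma finite_support_belowWt_summand {l : ℕ} (e : ℕ) {P : MP l} (s : Charge l)
    (hP : IsLPartition P) (i : ZMod e) (x : ℤ) :
    (Function.support fun y : ℤ =>
      if (y : ZMod e) = i ∧ y < x then contentWt P s y else 0).Finite := by
  refine (finite_support_contentWt s hP).subset fun y hy h => hy ?_
  simp [h]

lemma prefE_eq_belowWt_add {l e : ℕ} {P : MP l} (s : Charge l) (hP : IsLPartition P)
    {i : ZMod e} {x : ℤ} (hx : (x : ZMod e) = i) (c : Fin l) :
    prefE e P s i x c = belowWt e P s i x + prefInf P s x c := by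
  have hs : prefInf P s x c = ∑ᶠ y : ℤ, if y = x then prefInf P s x c else 0 :=
    (finsum_eq_single _ x fun y hy => by simp [hy]).trans (by simp) |>.symm
  rw [hs, belowWt, ← finsum_add_distrib (finite_support_belowWt_summand e s hP i x)
    ((Set.finite_singleton x).subset fun y hy => by by_contra h; exact hy (if_neg h))]
  refine finsum_congr fun y => ?_
  by_cases hy : (y : ZMod e) = i
  · rcases lt_trichotomy y x with h | rfl | h
    · simp [hy, h, h.ne, contentWt]
    · simp [hy]
    · simp [hy, h.not_gt, h.ne']
  · have : y ≠ x := by rintro rfl; exact hy hx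
    simp [hy, this]

lemma belowWt_eq_sub_add {l e : ℕ} (he : 0 < e) {P : MP l} (s : Charge l) (hP : IsLPartition P)
    {i : ZMod e} {x : ℤ} (hx : (x : ZMod e) = i) :
    belowWt e P s i x = belowWt e P s i (x - e) + contentWt P s (x - e) := by
  have hs : contentWt P s (x - e) =
      ∑ᶠ y : ℤ, if y = x - e then contentWt P s (x - e) else 0 :=
    (finsum_eq_single _ (x - e) fun y hy => by simp [hy]).trans (by simp) |>.symm
  rw [hs, belowWt, belowWt, ← finsum_add_distrib (finite_support_belowWt_summand e s hP i _)
    ((Set.finite_singleton (x - e : ℤ)).subset fun y hy => by by_contra h; exact hy (if_neg h))]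
  refine finsum_congr fun y => ?_
  by_cases hy : (y : ZMod e) = i
  · obtain ⟨k, hk⟩ := (ZMod.intCast_eq_intCast_iff_dvd_sub y x e).1 (hy.trans hx.symm)
    rcases lt_trichotomy y (x - e) with h | rfl | h
    · have : y < x := by omega
      simp [hy, h, h.ne, this]
    · have : x - e < x := by omega
      simp [hx, this]
    · have : ¬ y < x := by
        intro hlt
        have h₁ : 0 < k := by nlinarith
        have h₂ : k < 1 := by nlinarith
        omega
      simp [this, h.not_gt, h.ne']
  · have : y ≠ x - e := by rintro rfl; apply hy; simpa using hx
    simp [hy, this]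

lemma exists_belowWt_eq_zero {l : ℕ} (e : ℕ) {P : MP l} (s : Charge l) (hP : IsLPartition P)
    (i : ZMod e) : ∃ m : ℤ, ∀ x ≤ m, belowWt e P s i x = 0 := by
  obtain ⟨m, hm⟩ := (finite_support_contentWt s hP).bddBelow
  refine ⟨m, fun x hx => finsum_eq_zero_of_forall_eq_zero fun y => ?_⟩
  split_ifs with h
  · by_contra hne
    have := hm hne
    omega
  · rfl

lemma prefInf_zero {l : ℕ} (hl : 0 < l) (P : MP l) (s : Charge l) (x : ℤ) :
    prefInf P s x ⟨0, hl⟩ = contentWt P s x := by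
  rw [prefInf, contentWt, Finset.filter_true_of_mem]
  intro c _
  exact Fin.mk_le_of_le_val (Nat.zero_le _)

lemma prefInf_eq_add {l : ℕ} (P : MP l) (s : Charge l) (x : ℤ) (c : Fin l) :
    prefInf P s x c = (addA P s c x - remR P s c x) +
      if h : (c : ℕ) + 1 < l then prefInf P s x ⟨c + 1, h⟩ else 0 := by
  have hf : (Finset.univ.filter fun d : Fin l => c ≤ d) =
      insert c (Finset.univ.filter fun d : Fin l => c < d) := by
    ext d
    simp [le_iff_eq_or_lt, eq_comm]
  rw [prefInf, hf, Finset.sum_insert (by simp)]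
  congr 1
  split_ifs with h
  · rfl
  · refine Finset.sum_eq_zero fun d hd => ?_
    have := d.2
    simp only [Finset.mem_filter, Fin.lt_def] at hd
    omega

/-- If the prefix count of the `i`-word attains its positive maximum before content `x`,
then it attains it at an addable node of content less than `x`. -/
lemma exists_addable_prefE_eq {l e : ℕ} (hl : 0 < l) (he : 0 < e) {P : MP l} (s : Charge l)
    (hP : IsLPartition P) {i : ZMod e} {φ : ℤ} (hφ : 0 < φ)
    (hmax : ∀ x c, prefE e P s i x c ≤ φ) {x : ℤ} (hx : (x : ZMod e) = i)
    (hK : belowWt e P s i x = φ) :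
    ∃ y c, y < x ∧ (y : ZMod e) = i ∧ addA P s c y = 1 ∧ prefE e P s i y c = φ := by
  obtain ⟨m, hm⟩ := exists_belowWt_eq_zero e s hP i
  have hle : ∀ z : ℤ, (z : ZMod e) = i → belowWt e P s i z ≤ φ := by
    intro z hz
    have hz' : ((z - e : ℤ) : ZMod e) = i := by simpa using hz
    have := hmax (z - e) ⟨0, hl⟩
    rwa [prefE_eq_belowWt_add s hP hz', prefInf_zero, ← belowWt_eq_sub_add he s hP hz] at this
  induction hn : (x - m).toNat using Nat.strong_induction_on generalizing x with
  | _ n ih =>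
    have hxm : m < x := by
      by_contra h
      have := hm x (by omega)
      omega
    have hy : ((x - e : ℤ) : ZMod e) = i := by simpa using hx
    by_contra hno
    push Not at hno
    have hbelow : belowWt e P s i (x - e) ≠ φ := by
      intro h
      obtain ⟨y, c, hyx, h₁, h₂, h₃⟩ := ih (x - e - m).toNat (by omega) hy h rfl
      exact hno y c (by omega) h₁ h₂ h₃
    have hne : ∀ k (c : Fin l), l - (c : ℕ) = k → prefE e P s i (x - e) c ≠ φ := by
      intro k
      induction k with
      | zero => intro c hc; have := c.2; omega
      | succ k ihk =>
        intro c hc h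
        have hA := addA_eq_zero_of_ne_one fun hA => hno (x - e) c (by omega) hy hA h
        have hR := remR_nonneg P s c (x - e)
        rw [prefE_eq_belowWt_add s hP hy, prefInf_eq_add, hA] at h
        split_ifs at h with hlt
        · have h₁ := ihk ⟨c + 1, hlt⟩ (by simp only; omega)
          have h₂ := hmax (x - e) ⟨c + 1, hlt⟩
          rw [prefE_eq_belowWt_add s hP hy] at h₁ h₂
          omega
        · have := hle _ hy
          omega
    apply hne _ ⟨0, hl⟩ rfl
    rw [prefE_eq_belowWt_add s hP hy, prefInf_zero, ← belowWt_eq_sub_add he s hP hx, hK]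

lemma prefE_le_phiE {l e : ℕ} {P : MP l} {s : Charge l} {i : ZMod e} (hphi : 0 < phiE e P s i)
    (x : ℤ) (c : Fin l) : prefE e P s i x c ≤ phiE e P s i := by
  refine le_csSup ?_ (Set.mem_insert_of_mem _ ⟨x, c, rfl⟩)
  by_contra h
  have : phiE e P s i = 0 := Int.csSup_of_not_bddAbove h
  omega

/-- the good addable `i`-node of `λ` (for residues mod `e`) is also the
good addable `j`-node of `λ` for the `e = ∞` structure, where `j` is its content. -/
theorem goodAddable_inf_of_goodAddable {l e : ℕ} (hl : 0 < l) (he : 2 ≤ e)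
    (P : MP l) (s : Charge l) (hP : IsLPartition P) (i : ZMod e)
    (hphi : 0 < phiE e P s i) (x : ℤ) (c : Fin l)
    (hgood : IsGoodAddableE e P s i x c) :
    0 < phiInf P s x ∧ IsGoodAddableInf P s x c := by
  obtain ⟨hA, hx, heq, hfirst⟩ := hgood
  have he' : 0 < e := by omega
  have hmax := prefE_le_phiE hphi
  have hpref : ∀ d, prefE e P s i x d = belowWt e P s i x + prefInf P s x d :=
    prefE_eq_belowWt_add s hP hx
  have hle : ∀ d, prefInf P s x d ≤ prefInf P s x c := by
    intro d
    have := hmax x d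
    rw [← heq, hpref, hpref] at this
    omega
  have hpos : 0 < prefInf P s x c := by
    have hy : ((x - e : ℤ) : ZMod e) = i := by simpa using hx
    have hK := hmax (x - e) ⟨0, hl⟩
    rw [prefE_eq_belowWt_add s hP hy, prefInf_zero, ← belowWt_eq_sub_add he' s hP hx] at hK
    have hK' : belowWt e P s i x ≠ phiE e P s i := by
      intro h
      obtain ⟨y, d, hyx, hyi, hyA, hyp⟩ := exists_addable_prefE_eq hl he' s hP hphi hmax hx h
      have := hfirst y d hyA hyi hyp
      omega
    rw [hpref] at heq
    omega
  have hphiInf : phiInf P s x = prefInf P s x c := by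
    refine IsGreatest.csSup_eq ⟨Set.mem_insert_of_mem _ ⟨c, rfl⟩, ?_⟩
    rintro z (rfl | ⟨d, rfl⟩)
    · exact hpos.le
    · exact hle d
  refine ⟨hphiInf ▸ hpos, hA, hphiInf.symm, fun d hd hdp => ?_⟩
  have := hfirst x d hd hx (by rw [hpref, hdp, hphiInf, ← hpref, heq])
  rcases this with h | h
  · exact absurd h (lt_irrefl x)
  · exact h.2

end FockHW
end
end

section
/- Let t, t′ ∈ T_{l,e}, and let (a_k)_{k∈ℤ} and (a′_k)_{k∈ℤ} be finitely supported families of nonnegative integers such that a_k = 0 for all k ≤ t_0 + e and a′_k = 0 for all k ≤ t′_0 + e. If Λ_{t,∞} + Σ_k a_k ω_k = Λ_{t′,∞} + Σ_k a′_k ω_k in P_∞, then t = t′ and a_k = a′_k for all k. (Uniqueness of the decomposition of elements of P_{e,∞}.) -/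
/- Formalization of combinatorial notions from
   "A combinatorial decomposition of higher level Fock spaces"
   by N. Jacon and C. Lecouvey. -/

open scoped Classical

noncomputable section

namespace FockHW

theorem LamCh_apply_eq_card {l : ℕ} (t : Charge l) (j : ℤ) :
    LamCh t j = (Finset.univ.filter (fun c : Fin l => j = t c)).card := by
  simp [LamCh, Lam]

theorem LamCh_injective_of_monotone {l : ℕ} {t t' : Charge l} (ht : Monotone t)
    (ht' : Monotone t') (h : LamCh t = LamCh t') : t = t' := by
  have hm : Multiset.map t Finset.univ.val = Multiset.map t' Finset.univ.val := by
    ext j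
    have hj := congrFun h j
    rw [LamCh_apply_eq_card, LamCh_apply_eq_card] at hj
    rw [Multiset.count_map, Multiset.count_map]
    exact_mod_cast hj
  have hp : (List.ofFn t).Perm (List.ofFn t') := by
    rw [← Multiset.coe_eq_coe, ← Fin.univ_val_map, ← Fin.univ_val_map, hm]
  exact List.ofFn_injective (hp.eq_of_sortedLE ht.sortedLE_ofFn ht'.sortedLE_ofFn)

theorem LamCh_eq_zero_of_lt {l : ℕ} (hl : 0 < l) {t : Charge l} (ht : Monotone t) {j : ℤ}
    (hj : j < t ⟨0, hl⟩) : LamCh t j = 0 := by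
  refine Finset.sum_eq_zero fun c _ => if_neg ?_
  have : t ⟨0, hl⟩ ≤ t c := ht (Nat.zero_le _)
  omega

theorem LamCh_eq_zero_of_le {l e : ℕ} (hl : 0 < l) {t : Charge l} (ht : t ∈ Tle l e) {j : ℤ}
    (hj : t ⟨0, hl⟩ + (e : ℤ) ≤ j) : LamCh t j = 0 := by
  refine Finset.sum_eq_zero fun c _ => if_neg ?_
  have := ht.2 ⟨0, hl⟩ c
  omega

theorem LamCh_apply_head_pos {l : ℕ} (hl : 0 < l) (t : Charge l) : 0 < LamCh t (t ⟨0, hl⟩) := by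
  rw [LamCh_apply_eq_card]
  have : (⟨0, hl⟩ : Fin l) ∈ Finset.univ.filter (fun c => t ⟨0, hl⟩ = t c) := by simp
  exact_mod_cast Finset.card_pos.2 ⟨_, this⟩

theorem finsum_smul_omegaW_apply (e : ℕ) {a : ℤ → ℕ} (ha : (Function.support a).Finite) (j : ℤ) :
    (∑ᶠ k : ℤ, (a k : ℤ) • omegaW e k) j = (a (j - 1) : ℤ) - a (j + e - 1) := by
  have hs : Function.support (fun k : ℤ => (a k : ℤ) • omegaW e k) ⊆ ha.toFinset := by
    intro k hk
    simp only [Set.Finite.coe_toFinset, Function.mem_support] at hk ⊢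
    rintro h
    simp [h] at hk
  rw [finsum_eq_sum_of_support_subset _ hs, Finset.sum_apply]
  have h1 (k : ℤ) : (j = k + 1) ↔ (j - 1 = k) := by omega
  have h2 (k : ℤ) : (j - 1 = k - e) ↔ (j + e - 1 = k) := by omega
  simp only [Pi.smul_apply, omegaW, Lam, smul_eq_mul, mul_sub, mul_ite, mul_one, mul_zero,
    Finset.sum_sub_distrib, h1, h2, Finset.sum_ite_eq, Set.Finite.mem_toFinset,
    Function.mem_support]
  congr 1 <;> split_ifs with h <;> simp_all

theorem head_le_head_of_coeff_eq {l e : ℕ} (hl : 0 < l) (he : 2 ≤ e) {t t' : Charge l}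
    (ht' : Monotone t')
    {a a' : ℤ → ℕ} (haz : ∀ k : ℤ, k ≤ t ⟨0, hl⟩ + (e : ℤ) → a k = 0)
    (haz' : ∀ k : ℤ, k ≤ t' ⟨0, hl⟩ + (e : ℤ) → a' k = 0)
    (h : ∀ j : ℤ, LamCh t j + ((a (j - 1) : ℤ) - a (j + e - 1)) =
      LamCh t' j + ((a' (j - 1) : ℤ) - a' (j + e - 1))) :
    t' ⟨0, hl⟩ ≤ t ⟨0, hl⟩ := by
  by_contra! hlt
  have hj := h (t ⟨0, hl⟩)
  rw [haz _ (by omega), haz _ (by omega), haz' _ (by omega), haz' _ (by omega),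
    LamCh_eq_zero_of_lt hl ht' hlt] at hj
  have := LamCh_apply_head_pos hl t
  omega

theorem eq_zero_of_finite_support_of_periodic {b : ℤ → ℤ} (hb : (Function.support b).Finite)
    {e : ℕ} (he : 0 < e) {m : ℤ} (h : ∀ k, m ≤ k → b (k + e) = b k) {k : ℤ} (hk : m ≤ k) :
    b k = 0 := by
  by_contra hne
  have hn (n : ℕ) : b (k + n * e) = b k := by
    induction n with
    | zero => simp
    | succ n ih =>
      have hle : m ≤ k + n * e := hk.trans (le_add_of_nonneg_right (by positivity))
      rw [← ih, ← h _ hle]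
      congr 1
      push_cast
      ring
  refine Set.infinite_of_injective_forall_mem (f := fun n : ℕ => k + n * (e : ℤ)) ?_ ?_ hb
  · intro n n' hnn
    simpa [he.ne'] using hnn
  · intro n
    simpa [hn n] using hne

/-- uniqueness of the decomposition `ν = Λ_{t,∞} + Σ_k a_k ω_k`
of elements of `P_{e,∞}`. -/
theorem Pe_decomposition_unique {l e : ℕ} (hl : 0 < l) (he : 2 ≤ e)
    (t t' : Charge l) (ht : t ∈ Tle l e) (ht' : t' ∈ Tle l e)
    (a a' : ℤ → ℕ) (ha : (Function.support a).Finite) (ha' : (Function.support a').Finite)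
    (haz : ∀ k : ℤ, k ≤ t ⟨0, hl⟩ + (e : ℤ) → a k = 0)
    (haz' : ∀ k : ℤ, k ≤ t' ⟨0, hl⟩ + (e : ℤ) → a' k = 0)
    (heq : (LamCh t + ∑ᶠ k : ℤ, (a k : ℤ) • omegaW e k)
         = (LamCh t' + ∑ᶠ k : ℤ, (a' k : ℤ) • omegaW e k)) :
    t = t' ∧ a = a' := by
  have h (j : ℤ) : LamCh t j + ((a (j - 1) : ℤ) - a (j + e - 1)) =
      LamCh t' j + ((a' (j - 1) : ℤ) - a' (j + e - 1)) := by
    have := congrFun heq j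
    rwa [Pi.add_apply, Pi.add_apply, finsum_smul_omegaW_apply e ha,
      finsum_smul_omegaW_apply e ha'] at this
  have h0 : t ⟨0, hl⟩ = t' ⟨0, hl⟩ :=
    le_antisymm (head_le_head_of_coeff_eq hl he ht.1 haz' haz fun j => (h j).symm)
      (head_le_head_of_coeff_eq hl he ht'.1 haz haz' h)
  have hfin : (Function.support fun k => (a k : ℤ) - a' k).Finite := by
    refine (ha.union ha').subset fun k hk => ?_
    by_contra hk'
    simp_all
  have haa : a = a' := by
    funext k
    by_cases hk : k ≤ t ⟨0, hl⟩ + e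
    · rw [haz k hk, haz' k (h0 ▸ hk)]
    · have := eq_zero_of_finite_support_of_periodic hfin (e := e) (by omega)
        (m := t ⟨0, hl⟩ + e - 1) (fun k hk => ?_) (k := k) (by omega)
      · omega
      · have hj := h (k + 1)
        rw [LamCh_eq_zero_of_le hl ht (by omega), LamCh_eq_zero_of_le hl ht' (by omega),
          show k + 1 - 1 = k by ring, show k + 1 + e - 1 = k + e by ring] at hj
        omega
  subst haa
  exact ⟨LamCh_injective_of_monotone ht.1 ht'.1 (add_right_cancel heq), rfl⟩

end FockHW
end
end
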